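/- Let j ≥ 1 and let α ∈ M^i_{(j)} with 2i − j ≤ g. Then the element α′ = Σ_{n≥0} (−x₁)ⁿ·𝒟ⁿ(α) / ((n!)²·binom(2i−j−g−2, n)) of R (a finite sum, since 𝒟ⁿ(α) = 0 for n > i, and with all denominators nonzero since 2i−j−g−2 < 0) satisfies 𝒟(α′) = 0; in other words, α′ is a primitive element for the sl₂-action on R, i.e. f(α′) = 0 where f = −𝒟. -/

import Mathlib

/- We model `R = ℚ[x₁, x₂, …]` as `MvPolynomial ℕ ℚ`, the variable of index `v`
representing `x_{v+1}` (so `x_k = X (k-1)` for `k ≥ 1`). -/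

open MvPolynomial

noncomputable section

/-- Codimension grading: `codim x_{v+1} = v + 1`. -/
def codimW (d : ℕ →₀ ℕ) : ℕ := d.sum fun v e => (v + 1) * e

/-- Level grading: `ℓ(x_{v+1}) = v`. -/
def levelW (d : ℕ →₀ ℕ) : ℕ := d.sum fun v e => v * e

/-- Polishchuk's operator
`𝒟 = -g ∂₁ + (1/2) ∑_{m,n ≥ 1} binom(m+n, n) x_{m+n-1} ∂_m ∂_n` (cut off beyond the
variables occurring in the argument, which loses no nonzero terms). -/
def Dop (g : ℕ) (p : MvPolynomial ℕ ℚ) : MvPolynomial ℕ ℚ :=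
  -(g : ℚ) • pderiv 0 p +
    (1/2 : ℚ) •
      ∑ a ∈ Finset.range (p.vars.sup id + 1), ∑ b ∈ Finset.range (p.vars.sup id + 1),
        (((a + b + 2).choose (b + 1) : ℚ)) • (X (a + b) * pderiv a (pderiv b p))

/-- `M^i_{(j)}`: span of monomials in `x₂, x₃, …` (no `x₁`, i.e. exponent of the
variable of index `0` is zero) of codimension `i` and level `j`. -/
def Mij (i j : ℕ) : Submodule ℚ (MvPolynomial ℕ ℚ) :=
  Submodule.span ℚ
    { p | ∃ d : ℕ →₀ ℕ, d 0 = 0 ∧ codimW d = i ∧ levelW d = j ∧ p = monomial d (1 : ℚ) }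

/-- Generalized binomial coefficient `binom(z, n) = z(z−1)⋯(z−n+1)/n!` for `z : ℤ`. -/
def gbinom (z : ℤ) (n : ℕ) : ℚ :=
  (∏ t ∈ Finset.range n, ((z : ℚ) - t)) / (Nat.factorial n)

theorem pderiv_pderiv_comm {σ R : Type*} [CommSemiring R] (a b : σ) (p : MvPolynomial σ R) :
    pderiv a (pderiv b p) = pderiv b (pderiv a p) := by
  classical
  ext m
  rcases eq_or_ne a b with rfl | h
  · rfl
  · simp only [coeff_pderiv, Finsupp.add_apply, Finsupp.single_apply, h, h.symm, if_false, add_zero]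
    rw [add_right_comm]
    ring

/-- The operator `Dop g` with the sum cut off at the variables of index `< N`. -/
def truncDop (g N : ℕ) : MvPolynomial ℕ ℚ →ₗ[ℚ] MvPolynomial ℕ ℚ :=
  -(g : ℚ) • (pderiv 0).toLinearMap +
    (1/2 : ℚ) •
      ∑ a ∈ Finset.range N, ∑ b ∈ Finset.range N,
        (((a + b + 2).choose (b + 1) : ℚ)) •
          (LinearMap.mulLeft ℚ (X (a + b)) ∘ₗ (pderiv a).toLinearMap ∘ₗ (pderiv b).toLinearMap)

theorem truncDop_apply (g N : ℕ) (p : MvPolynomial ℕ ℚ) :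
    truncDop g N p = -(g : ℚ) • pderiv 0 p +
      (1/2 : ℚ) • ∑ a ∈ Finset.range N, ∑ b ∈ Finset.range N,
        (((a + b + 2).choose (b + 1) : ℚ)) • (X (a + b) * pderiv a (pderiv b p)) := by
  simp [truncDop, LinearMap.sum_apply]

theorem pderiv_eq_zero_of_sup_lt {p : MvPolynomial ℕ ℚ} {a : ℕ} (h : p.vars.sup id < a) :
    pderiv a p = 0 :=
  pderiv_eq_zero_of_notMem_vars fun ha =>
    absurd (Finset.le_sup (f := id) ha) (by simpa using h)

theorem Dop_eq_truncDop (g : ℕ) {N : ℕ} {p : MvPolynomial ℕ ℚ} (h : p.vars.sup id < N) :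
    Dop g p = truncDop g N p := by
  have hsub : Finset.range (p.vars.sup id + 1) ⊆ Finset.range N :=
    Finset.range_mono h
  have hz : ∀ a : ℕ, a ∉ Finset.range (p.vars.sup id + 1) → pderiv a p = 0 := fun a ha =>
    pderiv_eq_zero_of_sup_lt (by rw [Finset.mem_range] at ha; omega)
  rw [truncDop_apply, Dop]
  congr 2
  rw [Finset.sum_subset hsub]
  · refine Finset.sum_congr rfl fun a _ => Finset.sum_subset hsub fun b _ hb => ?_
    rw [hz b hb]
    simp
  · refine fun a _ ha => Finset.sum_eq_zero fun b _ => ?_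
    rw [pderiv_pderiv_comm, hz a ha]
    simp

theorem Dop_add (g : ℕ) (p q : MvPolynomial ℕ ℚ) : Dop g (p + q) = Dop g p + Dop g q := by
  set N := (p + q).vars.sup id + p.vars.sup id + q.vars.sup id + 1
  rw [Dop_eq_truncDop g (N := N) (by omega), Dop_eq_truncDop g (N := N) (p := p) (by omega),
    Dop_eq_truncDop g (N := N) (p := q) (by omega), map_add]

theorem Dop_smul (g : ℕ) (c : ℚ) (p : MvPolynomial ℕ ℚ) : Dop g (c • p) = c • Dop g p := by
  set N := (c • p).vars.sup id + p.vars.sup id + 1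
  rw [Dop_eq_truncDop g (N := N) (by omega), Dop_eq_truncDop g (N := N) (p := p) (by omega),
    map_smul]

/-- The weight `codim + (number of variables) = 2 codim - level`, as an integer weight. -/
def sumWeight (v : ℕ) : ℤ := v + 2

theorem sum_sumWeight_smul_X_mul_pderiv {p : MvPolynomial ℕ ℚ} {k : ℤ}
    (hp : IsWeightedHomogeneous sumWeight p k) {N : ℕ} (h : p.vars.sup id < N) :
    ∑ a ∈ Finset.range N, ((a : ℚ) + 2) • (X a * pderiv a p) = (k : ℚ) • p := by
  have hX : ∀ a, X a * pderiv a p = ∑ d ∈ p.support, d a • monomial d (coeff d p) := fun a => by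
    conv_lhs => rw [p.as_sum, map_sum, Finset.mul_sum]
    exact Finset.sum_congr rfl fun d _ => X_mul_pderiv_monomial
  simp_rw [hX, Finset.smul_sum]
  rw [Finset.sum_comm]
  conv_rhs => rw [p.as_sum, Finset.smul_sum]
  refine Finset.sum_congr rfl fun d hd => ?_
  have hs : d.support ⊆ Finset.range N := fun a ha => by
    have := Finset.le_sup (f := id) ((mem_vars_iff_mem_support a).2 ⟨d, hd, ha⟩)
    exact Finset.mem_range.2 (lt_of_le_of_lt this h)
  rw [← hp (mem_support_iff.1 hd), Finsupp.weight_apply,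
    Finsupp.sum_of_support_subset d hs _ (by simp), Int.cast_sum, Finset.sum_smul]
  refine Finset.sum_congr rfl fun a _ => ?_
  rw [← Nat.cast_smul_eq_nsmul ℚ, smul_smul]
  congr 1
  simp [sumWeight, mul_comm]

theorem Dop_X_zero_mul (g : ℕ) {p : MvPolynomial ℕ ℚ} {k : ℤ}
    (hp : IsWeightedHomogeneous sumWeight p k) :
    Dop g (X 0 * p) = X 0 * Dop g p + ((k : ℚ) - g) • p := by
  obtain ⟨N, hN⟩ : ∃ N, N = (X 0 * p).vars.sup id + p.vars.sup id + 1 := ⟨_, rfl⟩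
  have hpN : p.vars.sup id < N := by omega
  rw [Dop_eq_truncDop g (N := N) (by omega), Dop_eq_truncDop g hpN, truncDop_apply,
    truncDop_apply, sub_smul, ← sum_sumWeight_smul_X_mul_pderiv hp hpN]
  have hX : ∀ a, pderiv a (X 0 : MvPolynomial ℕ ℚ) = if a = 0 then 1 else 0 := fun a => by
    split_ifs with h
    · rw [h, pderiv_X_self]
    · exact pderiv_X_of_ne (Ne.symm h)
  have key : ∀ a b, pderiv a (pderiv b (X 0 * p)) = X 0 * pderiv a (pderiv b p) +
      (if a = 0 then pderiv b p else 0) + (if b = 0 then pderiv a p else 0) := fun a b => by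
    simp only [pderiv_mul, hX, map_add]
    split_ifs <;> simp <;> ring
  have h0 : 0 ∈ Finset.range N := Finset.mem_range.2 (by omega)
  have hsum : ∑ a ∈ Finset.range N, ∑ b ∈ Finset.range N,
      (((a + b + 2).choose (b + 1) : ℚ)) •
        (X (a + b) * pderiv a (pderiv b (X 0 * p)) : MvPolynomial ℕ ℚ) =
      X 0 * (∑ a ∈ Finset.range N, ∑ b ∈ Finset.range N,
      (((a + b + 2).choose (b + 1) : ℚ)) • (X (a + b) * pderiv a (pderiv b p))) +
      (2 : ℚ) • ∑ a ∈ Finset.range N, ((a : ℚ) + 2) • (X a * pderiv a p) := by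
    have h1 : ∑ a ∈ Finset.range N, ∑ b ∈ Finset.range N, (((a + b + 2).choose (b + 1) : ℚ)) •
        (X (a + b) * (if a = 0 then pderiv b p else 0) : MvPolynomial ℕ ℚ) =
        ∑ a ∈ Finset.range N, ((a : ℚ) + 2) • (X a * pderiv a p) := by
      rw [Finset.sum_eq_single_of_mem 0 h0 fun a _ ha => by simp [ha]]
      refine Finset.sum_congr rfl fun b _ => ?_
      rw [if_pos rfl, zero_add, Nat.choose_succ_self_right]
      push_cast
      rw [add_assoc, one_add_one_eq_two]
    have h2 : ∑ a ∈ Finset.range N, ∑ b ∈ Finset.range N, (((a + b + 2).choose (b + 1) : ℚ)) •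
        (X (a + b) * (if b = 0 then pderiv a p else 0) : MvPolynomial ℕ ℚ) =
        ∑ a ∈ Finset.range N, ((a : ℚ) + 2) • (X a * pderiv a p) := by
      refine Finset.sum_congr rfl fun a _ => ?_
      rw [Finset.sum_eq_single_of_mem 0 h0 fun b _ hb => by simp [hb]]
      rw [if_pos rfl, add_zero, zero_add, Nat.choose_one_right]
      push_cast
      rfl
    rw [two_smul, ← add_assoc]
    nth_rw 1 [← h1]
    rw [← h2]
    simp only [Finset.mul_sum, ← Finset.sum_add_distrib]
    refine Finset.sum_congr rfl fun a _ => Finset.sum_congr rfl fun b _ => ?_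
    rw [key, mul_add, mul_add, smul_add, smul_add, mul_left_comm, mul_smul_comm]
  rw [hsum, pderiv_mul, hX]
  simp only [if_true, one_mul, smul_add, mul_add, mul_smul_comm, smul_smul]
  norm_num
  abel

theorem isWeightedHomogeneous_Dop (g : ℕ) {p : MvPolynomial ℕ ℚ} {k : ℤ}
    (hp : IsWeightedHomogeneous sumWeight p k) :
    IsWeightedHomogeneous sumWeight (Dop g p) (k - 2) := by
  refine Submodule.add_mem (weightedHomogeneousSubmodule ℚ sumWeight (k - 2))
    (Submodule.smul_mem _ _ (hp.pderiv (by simp [sumWeight])))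
    (Submodule.smul_mem _ _ (Submodule.sum_mem _ fun a _ => Submodule.sum_mem _ fun b _ =>
      Submodule.smul_mem _ _ ?_))
  have h := (isWeightedHomogeneous_X ℚ sumWeight (a + b)).mul
    ((hp.pderiv (i := b) (n' := k - (b + 2)) (by simp [sumWeight])).pderiv (i := a)
      (n' := k - (b + 2) - (a + 2)) (by simp [sumWeight]))
  have hk : sumWeight (a + b) + (k - (b + 2) - (a + 2)) = k - 2 := by
    simp only [sumWeight]
    push_cast
    ring
  rwa [hk] at h

theorem isWeightedHomogeneous_Dop_iterate (g : ℕ) {p : MvPolynomial ℕ ℚ} {k : ℤ}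
    (hp : IsWeightedHomogeneous sumWeight p k) (n : ℕ) :
    IsWeightedHomogeneous sumWeight ((Dop g)^[n] p) (k - 2 * n) := by
  induction n with
  | zero => simpa using hp
  | succ n ih =>
    rw [Function.iterate_succ_apply']
    convert isWeightedHomogeneous_Dop g ih using 1
    push_cast
    ring

theorem eq_zero_of_isWeightedHomogeneous_neg {p : MvPolynomial ℕ ℚ} {k : ℤ}
    (hp : IsWeightedHomogeneous sumWeight p k) (hk : k < 0) : p = 0 := by
  refine hp.eq_zero_of_no_monomials fun d hd => ?_
  have : 0 ≤ Finsupp.weight sumWeight d :=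
    Finset.sum_nonneg fun v _ => nsmul_nonneg (by simp only [sumWeight]; positivity) _
  omega

theorem isWeightedHomogeneous_of_mem_Mij {i j : ℕ} {α : MvPolynomial ℕ ℚ} (hα : α ∈ Mij i j) :
    IsWeightedHomogeneous sumWeight α (2 * i - j) := by
  suffices h : Mij i j ≤ weightedHomogeneousSubmodule ℚ sumWeight (2 * i - j) from h hα
  refine Submodule.span_le.2 ?_
  rintro _ ⟨d, -, rfl, rfl, rfl⟩
  refine isWeightedHomogeneous_monomial _ _ _ ?_
  simp only [Finsupp.weight_apply, codimW, levelW, Finsupp.sum, sumWeight, Nat.cast_sum,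
    Finset.mul_sum, ← Finset.sum_sub_distrib]
  refine Finset.sum_congr rfl fun v _ => ?_
  push_cast
  simp only [nsmul_eq_mul]
  ring

theorem Dop_X_zero_pow_mul (g : ℕ) {p : MvPolynomial ℕ ℚ} {k : ℤ}
    (hp : IsWeightedHomogeneous sumWeight p k) (n : ℕ) :
    Dop g (X 0 ^ (n + 1) * p) =
      X 0 ^ (n + 1) * Dop g p + (((n : ℚ) + 1) * (k - g + n)) • (X 0 ^ n * p) := by
  induction n with
  | zero => simpa using Dop_X_zero_mul g hp
  | succ n ih =>
    have hn : IsWeightedHomogeneous sumWeight (X 0 ^ (n + 1) * p) (2 * (n + 1) + k) := by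
      convert! ((isWeightedHomogeneous_X ℚ sumWeight 0).pow (n + 1)).mul hp using 1
      simp only [sumWeight, nsmul_eq_mul]
      push_cast
      ring
    rw [pow_succ', mul_assoc, Dop_X_zero_mul g hn, ih, mul_add, mul_smul_comm, ← mul_assoc,
      ← pow_succ', ← mul_assoc (X 0) (X 0 ^ n), ← pow_succ', add_assoc, ← add_smul]
    congr 2
    push_cast
    ring

theorem gbinom_succ (z : ℤ) (n : ℕ) : ((n : ℚ) + 1) * gbinom z (n + 1) = (z - n) * gbinom z n := by
  have : (n.factorial : ℚ) ≠ 0 := by exact_mod_cast n.factorial_ne_zero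
  have : (n : ℚ) + 1 ≠ 0 := by positivity
  rw [gbinom, gbinom, Finset.prod_range_succ, Nat.factorial_succ]
  push_cast
  field_simp

theorem inv_factorial_sq_mul_gbinom_succ {z : ℤ} (hz : z < 0) (n : ℕ) :
    (((n + 1).factorial : ℚ) ^ 2 * gbinom z (n + 1))⁻¹ * ((n + 1) * (z - n)) =
      ((n.factorial : ℚ) ^ 2 * gbinom z n)⁻¹ := by
  have h1 : (n : ℚ) + 1 ≠ 0 := by positivity
  have h2 : (z : ℚ) - n ≠ 0 := by
    have : (z : ℚ) < 0 := by exact_mod_cast hz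
    have : (0 : ℚ) ≤ n := n.cast_nonneg
    linarith
  have h3 : ((n + 1).factorial : ℚ) ^ 2 * gbinom z (n + 1) =
      (n.factorial : ℚ) ^ 2 * gbinom z n * ((n + 1) * (z - n)) := by
    rw [Nat.factorial_succ]
    push_cast
    linear_combination ((n : ℚ) + 1) * (n.factorial : ℚ) ^ 2 * gbinom_succ z n
  rw [h3, mul_inv, mul_assoc, inv_mul_cancel₀ (mul_ne_zero h1 h2), mul_one]

/-- let `j ≥ 1` and `α ∈ M^i_{(j)}` with `2i − j ≤ g`.  The element
`α′ = ∑_{n≥0} (−x₁)ⁿ·𝒟ⁿ(α) / ((n!)²·binom(2i−j−g−2, n))` (a finite sum: `𝒟ⁿ(α) = 0`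
for `n > i`, so we sum over `0 ≤ n ≤ i`; all denominators are nonzero since
`2i−j−g−2 < 0`) satisfies `𝒟(α′) = 0`, i.e. `α′` is a primitive element for the
sl₂-action (`f(α′) = 0` where `f = −𝒟`). -/
theorem stmt18 (g : ℕ) (hg : 3 ≤ g) (i j : ℕ) (hj : 1 ≤ j) (hij : 2 * i ≤ g + j)
    (α : MvPolynomial ℕ ℚ) (hα : α ∈ Mij i j) :
    Dop g
      (∑ n ∈ Finset.range (i + 1),
        ((((n.factorial : ℚ) ^ 2 * gbinom (2 * (i : ℤ) - j - g - 2) n))⁻¹) •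
          ((- X 0) ^ n * (Dop g)^[n] α)) = 0 := by
  have hw := isWeightedHomogeneous_of_mem_Mij hα
  obtain ⟨z, hz⟩ : ∃ z : ℤ, z = 2 * (i : ℤ) - j - g - 2 := ⟨_, rfl⟩
  have hz0 : z < 0 := by omega
  rw [← hz]
  obtain ⟨c, hc⟩ : ∃ c : ℕ → ℚ, ∀ n, c n = ((n.factorial : ℚ) ^ 2 * gbinom z n)⁻¹ :=
    ⟨_, fun _ => rfl⟩
  have hrec : ∀ n : ℕ, c (n + 1) * ((n + 1) * (z - n)) = c n := fun n => by
    rw [hc, hc, inv_factorial_sq_mul_gbinom_succ hz0]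
  simp only [← hc]
  have hsum : ∀ m : ℕ, Dop g (∑ n ∈ Finset.range (m + 1), c n • ((-X 0) ^ n * (Dop g)^[n] α)) =
      c m • ((-X 0) ^ m * (Dop g)^[m + 1] α) := fun m => by
    induction m with
    | zero => simp [Dop_smul]
    | succ m ih =>
      rw [Finset.sum_range_succ, Dop_add, ih, Dop_smul, neg_pow (X 0 : MvPolynomial ℕ ℚ) (m + 1),
        neg_pow (X 0 : MvPolynomial ℕ ℚ) m,
        Function.iterate_succ_apply' _ (m + 1)]
      have hs : ∀ n : ℕ, ((-1) ^ n : MvPolynomial ℕ ℚ) = C ((-1) ^ n) := fun n => by simp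
      rw [hs, hs, mul_assoc, mul_assoc, mul_assoc, ← smul_eq_C_mul, ← smul_eq_C_mul,
        ← smul_eq_C_mul, Dop_smul, Dop_X_zero_pow_mul g (isWeightedHomogeneous_Dop_iterate g hw _),
        ← hrec m, hz]
      module
  rw [hsum, eq_zero_of_isWeightedHomogeneous_neg (isWeightedHomogeneous_Dop_iterate g hw _)
    (by push_cast; omega), mul_zero, smul_zero]
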